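/- Let S⃗ be a finite submodular separation system inside a universe of separations, and let 𝒫 be a set of profiles of S. Then there exists a nested set N ⊆ S of separations that distinguishes all the profiles in 𝒫 and contains only separations that are good for 𝒫. -/

import Mathlib

namespace SepSys

variable {U : Type*} [Lattice U]

/-- `inv` is an order-reversing involution on the universe `U`. -/
def IsInvol (inv : U → U) : Prop :=
  (∀ s, inv (inv s) = s) ∧ ∀ r s : U, r ≤ s → inv s ≤ inv r

/-- `Sv` is a separation system inside the universe `U`: a subset closed under the involution. -/
def IsSepSys (inv : U → U) (Sv : Set U) : Prop :=
  ∀ s ∈ Sv, inv s ∈ Sv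

/-- structural submodularity of a separation system inside a universe -/
def SubmodularSys (Sv : Set U) : Prop :=
  ∀ r ∈ Sv, ∀ s ∈ Sv, r ⊔ s ∈ Sv ∨ r ⊓ s ∈ Sv

/-- the (unoriented) separations underlying `r` and `s` are nested -/
def Nested (inv : U → U) (r s : U) : Prop :=
  r ≤ s ∨ r ≤ inv s ∨ inv r ≤ s ∨ inv r ≤ inv s

def NestedSet (inv : U → U) (N : Set U) : Prop :=
  ∀ r ∈ N, ∀ s ∈ N, Nested inv r s

def NestedWithAll (inv : U → U) (M : Set U) (s : U) : Prop :=
  ∀ m ∈ M, Nested inv s m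

/-- `N` represents a set of unoriented separations of `Sv`:
we represent such a set by the set of all orientations of its elements. -/
def UnorientedIn (inv : U → U) (Sv N : Set U) : Prop :=
  N ⊆ Sv ∧ ∀ s ∈ N, inv s ∈ N

/-- `O` is an orientation of (the set of unoriented separations of) `Sv` -/
def IsOrientation (inv : U → U) (Sv O : Set U) : Prop :=
  O ⊆ Sv ∧ (∀ s ∈ Sv, s ∈ O ∨ inv s ∈ O) ∧ ∀ s ∈ O, inv s ∈ O → inv s = s

def Consistent (inv : U → U) (O : Set U) : Prop :=
  ∀ a ∈ O, ∀ b ∈ O, a ≠ b → ¬ inv a < b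

def IsProfile (inv : U → U) (Sv P : Set U) : Prop :=
  IsOrientation inv Sv P ∧ Consistent inv P ∧ ∀ r ∈ P, ∀ s ∈ P, inv (r ⊔ s) ∉ P

def IsStarIn (inv : U → U) (Sv σ : Set U) : Prop :=
  σ ⊆ Sv ∧ (∀ s ∈ σ, inv s ≠ s) ∧ ∀ r ∈ σ, ∀ s ∈ σ, r ≠ s → r ≤ inv s

def IsFTangle (inv : U → U) (Sv : Set U) (F : Set (Set U)) (O : Set U) : Prop :=
  IsOrientation inv Sv O ∧ Consistent inv O ∧ ∀ σ ∈ F, ¬ σ ⊆ O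

/-- the non-degenerate separation underlying `s` distinguishes `O` and `O'` -/
def Distinguishes (inv : U → U) (s : U) (O O' : Set U) : Prop :=
  inv s ≠ s ∧ ((s ∈ O ∧ inv s ∈ O') ∨ (inv s ∈ O ∧ s ∈ O'))

def DistinguishesAll (inv : U → U) (N : Set U) (Ps : Set (Set U)) : Prop :=
  ∀ P ∈ Ps, ∀ P' ∈ Ps, P ≠ P' → ∃ s ∈ N, Distinguishes inv s P P'

def CloselyRelated (inv : U → U) (Sv O : Set U) (s : U) : Prop :=
  s ∈ O ∧ ∀ r ∈ O, s ⊓ r ∈ Sv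

def DistinguishesWell (inv : U → U) (Sv P P' : Set U) (s : U) : Prop :=
  (CloselyRelated inv Sv P s ∧ CloselyRelated inv Sv P' (inv s)) ∨
    (CloselyRelated inv Sv P' s ∧ CloselyRelated inv Sv P (inv s))

def GoodFor (inv : U → U) (Sv : Set U) (Ps : Set (Set U)) (s : U) : Prop :=
  ∃ P ∈ Ps, ∃ P' ∈ Ps, P ≠ P' ∧ DistinguishesWell inv Sv P P' s

def MaxElems (O : Set U) : Set U :=
  {x ∈ O | ∀ y ∈ O, x ≤ y → x = y}

/-- `σ` is a node of the nested set `N` (represented with all orientations of its elements) -/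
def IsNode (inv : U → U) (N σ : Set U) : Prop :=
  IsStarIn inv N σ ∧ ∃ O, IsOrientation inv N O ∧ Consistent inv O ∧ σ = MaxElems O

def IsTrivialIn (inv : U → U) (Sv : Set U) (s : U) : Prop :=
  ∃ r ∈ Sv, ({r, inv r} : Set U) ≠ {s, inv s} ∧ s < r ∧ s < inv r

def SmallSep (inv : U → U) (s : U) : Prop := s ≤ inv s

def StandardSet (inv : U → U) (Sv : Set U) (F : Set (Set U)) : Prop :=
  ∀ s ∈ Sv, IsTrivialIn inv Sv s → ({inv s} : Set U) ∈ F

def Emulates (inv : U → U) (Sv : Set U) (r s : U) : Prop :=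
  r ≤ s ∧ ∀ x ∈ Sv, r ≤ x → x ≠ inv r → s ⊔ x ∈ Sv

open Classical in
/-- the shifting map `f↓` -/
noncomputable def shiftMap (inv : U → U) (r s x : U) : U :=
  if r ≤ x then x ⊔ s else inv (inv x ⊔ s)

def ClosedUnderShifting (inv : U → U) (Sv : Set U) (F : Set (Set U)) : Prop :=
  ∀ r ∈ Sv, ∀ s ∈ Sv, inv r ≠ r → ¬ IsTrivialIn inv Sv r → Emulates inv Sv r s →
    ∀ σ ∈ F, (∀ x ∈ σ, x ∈ Sv ∧ (r ≤ x ∨ r ≤ inv x) ∧ x ≠ inv r) →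
      (∃ t ∈ σ, r ≤ t) → shiftMap inv r s '' σ ∈ F

def Friendly (inv : U → U) (Sv : Set U) (F : Set (Set U)) : Prop :=
  (∀ σ ∈ F, IsStarIn inv Sv σ) ∧ StandardSet inv Sv F ∧
    ClosedUnderShifting inv Sv F ∧
    (∀ s ∈ Sv, SmallSep inv s → ({inv s} : Set U) ∈ F) ∧
    ∀ O, IsFTangle inv Sv F O → IsProfile inv Sv O

def IsAut (inv : U → U) (Sv : Set U) (φ : U → U) : Prop :=
  Set.BijOn φ Sv Sv ∧ (∀ r ∈ Sv, ∀ s ∈ Sv, (r ≤ s ↔ φ r ≤ φ s)) ∧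
    ∀ s ∈ Sv, φ (inv s) = inv (φ s)

/-- the separations of `Sv` that are nested with all separations in `M` -/
def SvM (inv : U → U) (Sv M : Set U) : Set U :=
  {s ∈ Sv | NestedWithAll inv M s}

/-- the set `E_P` of `P`-exclusive separations in `P_M` distinguishing `P` well
from some other profile in `Ps` -/
def EP (inv : U → U) (Sv M : Set U) (Ps : Set (Set U)) (P : Set U) : Set U :=
  {s ∈ P ∩ SvM inv Sv M | (∀ P' ∈ Ps, s ∈ P' → P' = P) ∧
    ∃ P' ∈ Ps, P' ≠ P ∧ DistinguishesWell inv Sv P P' s}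

/-- the set `M_{P,i}` from the construction of the canonical nested set:
separations nested with the previously chosen set `N` that are `P`-exclusive
for the remaining profiles `Q` and maximal in `P ∩ S⃗_i` -/
def MpOf (inv : U → U) (Sv N : Set U) (Q : Set (Set U)) (P : Set U) : Set U :=
  {s ∈ SvM inv Sv N | s ∈ P ∧ (∀ P' ∈ Q, s ∈ P' → P' = P) ∧
    ∀ x ∈ P ∩ SvM inv Sv N, s ≤ x → s = x}

def QiOf (inv : U → U) (Sv N : Set U) (Q : Set (Set U)) : Set (Set U) :=
  {P ∈ Q | (MpOf inv Sv N Q P).Nonempty}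

/-- step `i` of the construction: the pair `(N_i, Ps_{≥ i+1})` -/
def constrStep (inv : U → U) (Sv : Set U) (Ps : Set (Set U)) : ℕ → Set U × Set (Set U)
  | 0 => (∅, Ps)
  | (i+1) =>
      let p := constrStep inv Sv Ps i
      (p.1 ∪ {x | ∃ P ∈ QiOf inv Sv p.1 p.2, ∃ y,
          IsGLB (MpOf inv Sv p.1 p.2 P) y ∧ (x = y ∨ x = inv y)},
        p.2 \ QiOf inv Sv p.1 p.2)

/-- the least `K` such that `Ps_{≥ K+1}` contains at most one profile -/
noncomputable def stopIndex (inv : U → U) (Sv : Set U) (Ps : Set (Set U)) : ℕ :=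
  sInf {i | ((constrStep inv Sv Ps i).2).Subsingleton}

/-- the canonical nested set `N(S⃗, Ps)` -/
noncomputable def canonicalN (inv : U → U) (Sv : Set U) (Ps : Set (Set U)) : Set U :=
  (constrStep inv Sv Ps (stopIndex inv Sv Ps)).1

end SepSys

namespace SepSys

variable {U : Type*} [Lattice U] {inv : U → U} {Sv P P' Q A : Set U} {s t x y : U}

theorem IsInvol.map_sup (h : IsInvol inv) (x y : U) : inv (x ⊔ y) = inv x ⊓ inv y := by
  apply le_antisymm
  · exact le_inf (h.2 _ _ le_sup_left) (h.2 _ _ le_sup_right)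
  · have hx := h.2 _ _ (inf_le_left : inv x ⊓ inv y ≤ inv x)
    have hy := h.2 _ _ (inf_le_right : inv x ⊓ inv y ≤ inv y)
    rw [h.1] at hx hy
    simpa [h.1] using h.2 _ _ (sup_le hx hy)

theorem IsInvol.map_inf (h : IsInvol inv) (x y : U) : inv (x ⊓ y) = inv x ⊔ inv y := by
  have := h.map_sup (inv x) (inv y)
  rw [h.1, h.1] at this
  rw [← this, h.1]

theorem IsProfile.mem_sys (hP : IsProfile inv Sv P) (hs : s ∈ P) : s ∈ Sv := hP.1.1 hs

theorem IsProfile.inv_notMem (hP : IsProfile inv Sv P) (hs : s ∈ P) : inv s ∉ P := by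
  simpa using hP.2.2 s hs s hs

theorem IsProfile.sup_mem (hP : IsProfile inv Sv P) (hx : x ∈ P) (hy : y ∈ P)
    (h : x ⊔ y ∈ Sv) : x ⊔ y ∈ P :=
  (hP.1.2.1 _ h).resolve_right (hP.2.2 x hx y hy)

theorem IsProfile.mem_of_le (hP : IsProfile inv Sv P) (hinv : IsInvol inv) (hx : x ∈ Sv)
    (hy : y ∈ P) (hxy : x ≤ y) (hne : inv x ≠ y) : x ∈ P := by
  by_contra hxP
  have hix : inv x ∈ P := (hP.1.2.1 x hx).resolve_left hxP
  refine hP.2.1 _ hix y hy hne (lt_of_le_of_ne (by rwa [hinv.1]) ?_)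
  rw [hinv.1]
  rintro rfl
  exact hxP hy

/-- Two separations in a common profile that are comparable: every profile containing the larger
one contains the smaller one. -/
theorem IsProfile.mem_of_le_of_mem (hP : IsProfile inv Sv P) (hQ : IsProfile inv Sv Q)
    (hinv : IsInvol inv) (hx : x ∈ Q) (hy : y ∈ Q) (hxy : x ≤ y) (hyP : y ∈ P) : x ∈ P :=
  hP.mem_of_le hinv (hQ.mem_sys hx) hyP hxy fun h => hQ.inv_notMem hx (h ▸ hy)

theorem IsProfile.inf_mem (hP : IsProfile inv Sv P) (hinv : IsInvol inv) (hx : x ∈ P)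
    (hy : y ∈ P) (h : x ⊓ y ∈ Sv) : x ⊓ y ∈ P := by
  by_cases hxe : inv (x ⊓ y) = x
  · by_cases hye : inv (x ⊓ y) = y
    · have hxy : x = y := hxe.symm.trans hye
      subst hxy
      rw [inf_idem] at hxe
      exact absurd (hxe.symm ▸ hx) (hP.inv_notMem hx)
    · exact hP.mem_of_le hinv h hy inf_le_right hye
  · exact hP.mem_of_le hinv h hx inf_le_left hxe

/-- `s` is minimal among the separations that are closely related to `P` and
distinguish `P` from `P'`. -/
def MinClosely (inv : U → U) (Sv P P' : Set U) (s : U) : Prop :=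
  Minimal (fun x => CloselyRelated inv Sv P x ∧ inv x ∈ P') s

theorem exists_closelyRelated (hinv : IsInvol inv) (hfin : Sv.Finite) (hsys : IsSepSys inv Sv)
    (hsub : SubmodularSys Sv) (hP : IsProfile inv Sv P) (hP' : IsProfile inv Sv P')
    (hne : P ≠ P') : ∃ s, CloselyRelated inv Sv P s ∧ inv s ∈ P' := by
  have h0 : ∃ s, s ∈ P ∧ inv s ∈ P' := by
    by_contra! h
    apply hne
    have key : ∀ s ∈ P, s ∈ P' := fun s hs =>
      (hP'.1.2.1 s (hP.mem_sys hs)).resolve_right (h s hs)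
    refine Set.Subset.antisymm key fun s hs => ?_
    by_contra hsP
    exact hP'.inv_notMem hs
      (key _ ((hP.1.2.1 s (hP'.mem_sys hs)).resolve_left hsP))
  obtain ⟨s, hs⟩ := Set.Finite.exists_maximal
    (hfin.subset fun s (hs : s ∈ {s | s ∈ P ∧ inv s ∈ P'}) => hP.mem_sys hs.1) h0
  refine ⟨s, ⟨hs.prop.1, fun r hr => ?_⟩, hs.prop.2⟩
  obtain ⟨hsP, hsP'⟩ := hs.prop
  rcases hsub s (hP.mem_sys hsP) r (hP.mem_sys hr) with h | h
  · have hm := hP.sup_mem hsP hr h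
    have hm' : inv (s ⊔ r) ∈ P' := by
      refine hP'.mem_of_le hinv (hsys _ h) hsP' (hinv.2 _ _ le_sup_left) fun he => ?_
      rw [hinv.1] at he
      exact hP.inv_notMem hsP (he ▸ hm)
    have hle : s ⊔ r ≤ s := hs.le_of_ge ⟨hm, hm'⟩ le_sup_left
    rw [inf_eq_right.2 (le_sup_right.trans hle)]
    exact hP.mem_sys hr
  · exact h

theorem exists_minClosely_le (hfin : Sv.Finite) (hP : IsProfile inv Sv P)
    (hs : CloselyRelated inv Sv P s) (hs' : inv s ∈ P') :
    ∃ x, x ≤ s ∧ MinClosely inv Sv P P' x := by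
  have hf : {x | CloselyRelated inv Sv P x ∧ inv x ∈ P'}.Finite :=
    hfin.subset fun x hx => hP.mem_sys hx.1.1
  obtain ⟨x, hxs, hx⟩ := hf.exists_le_minimal (a := s) ⟨hs, hs'⟩
  exact ⟨x, hxs, hx⟩

theorem MinClosely.closelyRelated_inv (hinv : IsInvol inv) (hfin : Sv.Finite)
    (hsys : IsSepSys inv Sv) (hsub : SubmodularSys Sv) (hP : IsProfile inv Sv P)
    (hP' : IsProfile inv Sv P') (ht : MinClosely inv Sv P P' t) :
    CloselyRelated inv Sv P' (inv t) := by
  obtain ⟨⟨⟨htP, htr⟩, htP'⟩, hmin⟩ := ht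
  refine ⟨htP', ?_⟩
  by_contra! hbad
  have htS := hP.mem_sys htP
  have hinf : ∀ x ∈ Sv, t ⊔ x ∉ Sv → t ⊓ x ∈ Sv := fun x hx h =>
    (hsub t htS x hx).resolve_left h
  -- a separation `t ⊓ x` that is as large as possible turns out to be closely related to `P`
  set B : Set U := {u | ∃ x ∈ Sv, inv x ∈ P' ∧ t ⊔ x ∉ Sv ∧ u = t ⊓ x} with hB
  have hBfin : B.Finite := hfin.subset fun u ⟨x, hx, _, h, hu⟩ => hu ▸ hinf x hx h
  have hBne : B.Nonempty := by
    obtain ⟨r, hr, hrn⟩ := hbad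
    refine ⟨_, inv r, hsys _ (hP'.mem_sys hr), by rwa [hinv.1], fun h => hrn ?_, rfl⟩
    simpa [hinv.map_sup, hinv.1] using hsys _ h
  obtain ⟨u, hu⟩ := hBfin.exists_maximal hBne
  obtain ⟨x, hx, hxP', htx, hux⟩ := hu.prop
  have huS : u ∈ Sv := hux ▸ hinf x hx htx
  have hiu : inv u = inv t ⊔ inv x := by rw [hux, hinv.map_inf]
  have huP' : inv u ∈ P' := by
    rw [hiu]
    exact hP'.sup_mem htP' hxP' (hiu ▸ hsys _ huS)
  have hut : u ≤ t := hux ▸ inf_le_left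
  have huP : u ∈ P := hP.mem_of_le hinv huS htP hut fun h => hP'.inv_notMem (h ▸ huP') htP'
  have huc : CloselyRelated inv Sv P u := by
    refine ⟨huP, fun q hq => ?_⟩
    by_contra hn
    have htq : t ⊓ q ∈ Sv := htr q hq
    have heq : u ⊓ q = (t ⊓ q) ⊓ x := by rw [hux, inf_right_comm]
    rw [heq] at hn
    have hyS : (t ⊓ q) ⊔ x ∈ Sv := (hsub _ htq x hx).resolve_right hn
    have hty : t ⊔ ((t ⊓ q) ⊔ x) ∉ Sv := by
      rwa [← sup_assoc, sup_inf_self]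
    have hyP' : inv ((t ⊓ q) ⊔ x) ∈ P' := by
      refine hP'.mem_of_le hinv (hsys _ hyS) hxP' (hinv.2 _ _ le_sup_right) fun he => ?_
      rw [hinv.1] at he
      have hxix : x ≤ inv x := he ▸ le_sup_right
      by_cases hb : inv x = inv u
      · have hxt : x ≤ t := by
          have := congrArg inv hb
          rw [hinv.1, hinv.1] at this
          exact this.trans_le hut
        exact htx (by rwa [sup_eq_left.2 hxt])
      · refine hP'.2.1 _ hxP' _ huP' hb ?_
        rw [hinv.1]
        exact lt_of_le_of_lt hxix (lt_of_le_of_ne (by rw [hiu]; exact le_sup_right) hb)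
    have hle : t ⊓ ((t ⊓ q) ⊔ x) ≤ u :=
      hu.le_of_ge ⟨_, hyS, hyP', hty, rfl⟩ (by
        rw [hux]
        exact inf_le_inf_left _ le_sup_right)
    have hle' : t ⊓ q ≤ x :=
      ((le_inf inf_le_left le_sup_left).trans hle).trans (hux ▸ inf_le_right)
    rw [inf_eq_left.2 hle'] at hn
    exact hn htq
  have htx' : t ≤ x := (hmin ⟨huc, huP'⟩ hut).trans (hux ▸ inf_le_right)
  exact htx (by rwa [sup_eq_right.2 htx'])

theorem MinClosely.le_of_closelyRelated (hinv : IsInvol inv) (hsys : IsSepSys inv Sv)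
    (hP : IsProfile inv Sv P) (hP' : IsProfile inv Sv P') (hQ : IsProfile inv Sv Q)
    (hs : MinClosely inv Sv P P' s) (hsQ : s ∈ Q) (ht : CloselyRelated inv Sv Q t)
    (htP' : inv t ∈ P') : s ≤ t := by
  obtain ⟨⟨⟨hsP, hsr⟩, hsP'⟩, hmin⟩ := hs
  have hst : s ⊓ t ∈ Sv := inf_comm t s ▸ ht.2 s hsQ
  have hstP : s ⊓ t ∈ P :=
    hP.mem_of_le_of_mem hQ hinv (hQ.inf_mem hinv hsQ ht.1 hst) hsQ inf_le_left hsP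
  have hc : CloselyRelated inv Sv P (s ⊓ t) := by
    refine ⟨hstP, fun p hp => ?_⟩
    have hspQ : s ⊓ p ∈ Q := hQ.mem_of_le_of_mem hP hinv
      (hP.inf_mem hinv hsP hp (hsr p hp)) hsP inf_le_left hsQ
    have := ht.2 _ hspQ
    rwa [inf_comm, inf_right_comm] at this
  have hi : inv (s ⊓ t) ∈ P' := by
    have h := hsys _ hst
    rw [hinv.map_inf] at h ⊢
    exact hP'.sup_mem hsP' htP' h
  exact (hmin ⟨hc, hi⟩ inf_le_left).trans inf_le_right

/-- For every profile `A`, a finite set of profiles is distinguished by a nested set of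
separations in `A`, each of which is minimal as in `MinClosely` for two of the profiles. -/
theorem exists_nested_minClosely (hinv : IsInvol inv) (hfin : Sv.Finite)
    (hsys : IsSepSys inv Sv) (hsub : SubmodularSys Sv) (K : Finset (Set U))
    (hK : ∀ P ∈ K, IsProfile inv Sv P) (hA : IsProfile inv Sv A) :
    ∃ N ⊆ A, NestedSet inv N ∧
      (∀ s ∈ N, ∃ P ∈ K, ∃ P' ∈ K, MinClosely inv Sv P P' s) ∧
      ∀ P ∈ K, ∀ P' ∈ K, P ≠ P' → ∃ s ∈ N, (s ∈ P ∧ inv s ∈ P') ∨ (inv s ∈ P ∧ s ∈ P') := by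
  classical
  induction K using Finset.strongInduction generalizing A with
  | H K ih =>
    by_cases hsing : ∀ P ∈ K, ∀ P' ∈ K, P = P'
    · exact ⟨∅, Set.empty_subset _, by simp [NestedSet], by simp,
        fun P hP P' hP' h => absurd (hsing P hP P' hP') h⟩
    have hex : ∃ Q ∈ K, ∃ Q' ∈ K, ∃ n ∈ A, MinClosely inv Sv Q Q' n := by
      push Not at hsing
      obtain ⟨Q, hQK, Q', hQK', hne⟩ := hsing
      have hQ := hK Q hQK
      have hQ' := hK Q' hQK'
      obtain ⟨s, hs, hs'⟩ := exists_closelyRelated hinv hfin hsys hsub hQ hQ' hne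
      obtain ⟨n, -, hn⟩ := exists_minClosely_le hfin hQ hs hs'
      rcases hA.1.2.1 n (hQ.mem_sys hn.prop.1.1) with h | h
      · exact ⟨Q, hQK, Q', hQK', n, h, hn⟩
      · have hc := hn.closelyRelated_inv hinv hfin hsys hsub hQ hQ'
        obtain ⟨m, hmn, hm⟩ := exists_minClosely_le hfin hQ' hc (P' := Q)
          (by rw [hinv.1]; exact hn.prop.1.1)
        exact ⟨Q', hQK', Q, hQK, m,
          hA.mem_of_le_of_mem hQ' hinv hm.prop.1.1 hc.1 hmn h, hm⟩
    obtain ⟨Q, hQK, Q', hQK', n, hnA, hn⟩ := hex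
    have hQ := hK Q hQK
    have hQ' := hK Q' hQK'
    have hnS : n ∈ Sv := hA.mem_sys hnA
    have hnQ : n ∈ Q := hn.prop.1.1
    have hnQ' : inv n ∈ Q' := hn.prop.2
    have hlt₁ : K.filter (n ∈ ·) ⊂ K :=
      Finset.filter_ssubset.2 ⟨Q', hQK', fun h => hQ'.inv_notMem h hnQ'⟩
    have hlt₂ : K.filter (n ∉ ·) ⊂ K := Finset.filter_ssubset.2 ⟨Q, hQK, not_not.2 hnQ⟩
    obtain ⟨N₁, hN₁A, hN₁, hN₁K, hN₁d⟩ :=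
      ih _ hlt₁ (fun P hP => hK P (Finset.mem_filter.1 hP).1) hA
    obtain ⟨N₂, hN₂Q, hN₂, hN₂K, hN₂d⟩ :=
      ih _ hlt₂ (fun P hP => hK P (Finset.mem_filter.1 hP).1) hQ
    have hle₁ : ∀ t ∈ N₁, n ≤ t ∨ n ≤ inv t := by
      intro t ht
      obtain ⟨R, hR, R', hR', htR⟩ := hN₁K t ht
      obtain ⟨hRK, hnR⟩ := Finset.mem_filter.1 hR
      obtain ⟨hRK', hnR'⟩ := Finset.mem_filter.1 hR'
      have hc := htR.closelyRelated_inv hinv hfin hsys hsub (hK R hRK) (hK R' hRK')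
      rcases hQ'.1.2.1 t (hA.mem_sys (hN₁A ht)) with h | h
      · exact .inr (hn.le_of_closelyRelated hinv hsys hQ hQ' (hK R' hRK') hnR' hc
          (by rwa [hinv.1]))
      · exact .inl (hn.le_of_closelyRelated hinv hsys hQ hQ' (hK R hRK) hnR htR.prop.1 h)
    have hle₂ : ∀ t ∈ N₂, t ≤ n := by
      intro t ht
      obtain ⟨R, hR, R', hR', htR⟩ := hN₂K t ht
      obtain ⟨hRK, -⟩ := Finset.mem_filter.1 hR
      obtain ⟨hRK', hnR'⟩ := Finset.mem_filter.1 hR'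
      exact htR.le_of_closelyRelated hinv hsys (hK R hRK) (hK R' hRK') hQ (hN₂Q ht)
        hn.prop.1 (((hK R' hRK').1.2.1 n hnS).resolve_left hnR')
    refine ⟨insert n (N₁ ∪ N₂), ?_, ?_, ?_, ?_⟩
    · rintro t (rfl | ht | ht)
      · exact hnA
      · exact hN₁A ht
      · exact hA.mem_of_le_of_mem hQ hinv (hN₂Q ht) hnQ (hle₂ t ht) hnA
    · rintro r (rfl | hr | hr) t (rfl | ht | ht)
      · exact .inl le_rfl
      · exact (hle₁ t ht).imp id .inl
      · exact .inr (.inr (.inr (hinv.2 _ _ (hle₂ t ht))))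
      · rcases hle₁ r hr with h | h
        · exact .inr (.inr (.inr (hinv.2 _ _ h)))
        · refine .inr (.inl ?_)
          simpa [hinv.1] using hinv.2 _ _ h
      · exact hN₁ r hr t ht
      · have h2 := hle₂ t ht
        rcases hle₁ r hr with h | h
        · exact .inr (.inr (.inr (hinv.2 _ _ (h2.trans h))))
        · refine .inr (.inl ?_)
          simpa [hinv.1] using hinv.2 _ _ (h2.trans h)
      · exact .inl (hle₂ r hr)
      · exact (hle₁ t ht).imp (hle₂ r hr).trans fun h => .inl ((hle₂ r hr).trans h)
      · exact hN₂ r hr t ht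
    · rintro t (rfl | ht | ht)
      · exact ⟨Q, hQK, Q', hQK', hn⟩
      · obtain ⟨R, hR, R', hR', h⟩ := hN₁K t ht
        exact ⟨R, hlt₁.1 hR, R', hlt₁.1 hR', h⟩
      · obtain ⟨R, hR, R', hR', h⟩ := hN₂K t ht
        exact ⟨R, hlt₂.1 hR, R', hlt₂.1 hR', h⟩
    · intro P hP P' hP' hne
      have hor : ∀ R ∈ K, n ∉ R → inv n ∈ R := fun R hR h =>
        ((hK R hR).1.2.1 n hnS).resolve_left h
      by_cases h : n ∈ P <;> by_cases h' : n ∈ P'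
      · obtain ⟨t, ht, htd⟩ := hN₁d P (Finset.mem_filter.2 ⟨hP, h⟩) P'
          (Finset.mem_filter.2 ⟨hP', h'⟩) hne
        exact ⟨t, .inr (.inl ht), htd⟩
      · exact ⟨n, .inl rfl, .inl ⟨h, hor P' hP' h'⟩⟩
      · exact ⟨n, .inl rfl, .inr ⟨hor P hP h, h'⟩⟩
      · obtain ⟨t, ht, htd⟩ := hN₂d P (Finset.mem_filter.2 ⟨hP, h⟩) P'
          (Finset.mem_filter.2 ⟨hP', h'⟩) hne
        exact ⟨t, .inr (.inr ht), htd⟩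

theorem Nested.inv_left (hinv : IsInvol inv) (h : Nested inv s t) : Nested inv (inv s) t := by
  unfold Nested at *
  rw [hinv.1]
  tauto

theorem Nested.inv_right (hinv : IsInvol inv) (h : Nested inv s t) : Nested inv s (inv t) := by
  unfold Nested at *
  rw [hinv.1]
  tauto

end SepSys

open SepSys

theorem good_tree_of_tangles {U : Type*} [Lattice U] (inv : U → U) (Sv : Set U)
    (hinv : IsInvol inv) (hfin : Sv.Finite) (hsys : IsSepSys inv Sv)
    (hsub : SubmodularSys Sv)
    (Ps : Set (Set U)) (hPs : ∀ P ∈ Ps, IsProfile inv Sv P) :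
    ∃ N : Set U, UnorientedIn inv Sv N ∧ NestedSet inv N ∧
      DistinguishesAll inv N Ps ∧ ∀ s ∈ N, GoodFor inv Sv Ps s := by
  rcases Ps.eq_empty_or_nonempty with rfl | ⟨A, hA⟩
  · exact ⟨∅, by simp [UnorientedIn], by simp [NestedSet], by simp [DistinguishesAll], by simp⟩
  have hPsfin : Ps.Finite := hfin.finite_subsets.subset fun P hP => (hPs P hP).1.1
  obtain ⟨N, hNA, hN, hNK, hNd⟩ := exists_nested_minClosely hinv hfin hsys hsub
    hPsfin.toFinset (fun P hP => hPs P (hPsfin.mem_toFinset.1 hP)) (hPs A hA)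
  simp only [Set.Finite.mem_toFinset] at hNK hNd
  have hNS : N ⊆ Sv := hNA.trans (hPs A hA).1.1
  refine ⟨N ∪ inv '' N, ⟨?_, ?_⟩, ?_, ?_, ?_⟩
  · rintro s (hs | ⟨s, hs, rfl⟩)
    · exact hNS hs
    · exact hsys s (hNS hs)
  · rintro s (hs | ⟨s, hs, rfl⟩)
    · exact .inr ⟨s, hs, rfl⟩
    · rw [hinv.1]
      exact .inl hs
  · rintro r (hr | ⟨r, hr, rfl⟩) s (hs | ⟨s, hs, rfl⟩)
    · exact hN r hr s hs
    · exact (hN r hr s hs).inv_right hinv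
    · exact (hN r hr s hs).inv_left hinv
    · exact ((hN r hr s hs).inv_right hinv).inv_left hinv
  · intro P hP P' hP' hne
    obtain ⟨s, hs, hd⟩ := hNd P hP P' hP' hne
    refine ⟨s, .inl hs, fun h => ?_, hd⟩
    exact (hPs A hA).inv_notMem (hNA hs) (h.symm ▸ hNA hs)
  · have hgood : ∀ s ∈ N, ∃ P ∈ Ps, ∃ P' ∈ Ps, P ≠ P' ∧
        CloselyRelated inv Sv P s ∧ CloselyRelated inv Sv P' (inv s) := by
      intro s hs
      obtain ⟨P, hP, P', hP', h⟩ := hNK s hs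
      have hc := h.closelyRelated_inv hinv hfin hsys hsub (hPs P hP) (hPs P' hP')
      refine ⟨P, hP, P', hP', ?_, h.prop.1, hc⟩
      rintro rfl
      exact (hPs P hP).inv_notMem h.prop.1.1 hc.1
    rintro s (hs | ⟨s, hs, rfl⟩)
    · obtain ⟨P, hP, P', hP', hne, h⟩ := hgood s hs
      exact ⟨P, hP, P', hP', hne, .inl h⟩
    · obtain ⟨P, hP, P', hP', hne, h, h'⟩ := hgood s hs
      exact ⟨P, hP, P', hP', hne, .inr ⟨h', by rwa [hinv.1]⟩⟩
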